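/- Let k be a field, Λ a k-algebra, and G, C, Y Λ-modules. Set D = G × C, let E = End_Λ(D), let e ∈ E be the projection (g, c) ↦ (0, c), let ι_G : G → D be the inclusion g ↦ (g, 0), let K ⊆ Hom_Λ(D, Y) be the additive subgroup generated by {f ∘ e ∘ r : f ∈ Hom_Λ(D, Y), r ∈ E}, and let I_Y ⊆ Hom_Λ(G, Y) be the subgroup of Λ-linear maps G → Y factoring through a finite power of C. Then the map g ↦ (class of g ∘ ι_G) induces an isomorphism of additive groups Hom_Λ(D, Y)/K ≅ Hom_Λ(G, Y)/I_Y. -/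

import Mathlib

/-- The subgroup of `Hom_Λ(G, Y)` of maps factoring through a finite power of `C`. -/
def factorThroughPowers (Λ C G Y : Type*) [Ring Λ] [AddCommGroup G] [Module Λ G]
    [AddCommGroup C] [Module Λ C] [AddCommGroup Y] [Module Λ Y] :
    AddSubgroup (G →ₗ[Λ] Y) where
  carrier := {f | ∃ (n : ℕ) (h : G →ₗ[Λ] (Fin n → C))
    (g' : (Fin n → C) →ₗ[Λ] Y), f = g'.comp h}
  zero_mem' := ⟨0, 0, 0, by ext x; simp⟩
  add_mem' := by
    rintro f₁ f₂ ⟨n₁, h₁, g₁, rfl⟩ ⟨n₂, h₂, g₂, rfl⟩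
    let eqv : (Fin (n₁ + n₂) → C) ≃ₗ[Λ] (Fin n₁ → C) × (Fin n₂ → C) :=
      (LinearEquiv.funCongrLeft Λ C finSumFinEquiv).trans
        (LinearEquiv.sumArrowLequivProdArrow (Fin n₁) (Fin n₂) Λ C)
    refine ⟨n₁ + n₂, eqv.symm.toLinearMap.comp (h₁.prod h₂),
      (g₁.coprod g₂).comp eqv.toLinearMap, ?_⟩
    ext x
    simp [LinearMap.comp_apply]
  neg_mem' := by
    rintro f ⟨n, h, g, rfl⟩
    exact ⟨n, h, -g, by ext x; simp⟩

/-- Precomposition with a linear map, as a homomorphism of additive groups. -/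
def LinearMap.precompAddHom {Λ M N : Type*} (Y : Type*) [Ring Λ] [AddCommGroup M] [Module Λ M]
    [AddCommGroup N] [Module Λ N] [AddCommGroup Y] [Module Λ Y] (a : M →ₗ[Λ] N) :
    (N →ₗ[Λ] Y) →+ (M →ₗ[Λ] Y) where
  toFun f := f.comp a
  map_zero' := LinearMap.zero_comp a
  map_add' f g := LinearMap.add_comp a g f

/-- A map factoring through `C` factors through a finite power of `C`. -/
theorem comp_mem_factorThroughPowers {Λ C G Y : Type*} [Ring Λ] [AddCommGroup G] [Module Λ G]
    [AddCommGroup C] [Module Λ C] [AddCommGroup Y] [Module Λ Y]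
    (b : C →ₗ[Λ] Y) (a : G →ₗ[Λ] C) : b.comp a ∈ factorThroughPowers Λ C G Y :=
  ⟨1, LinearMap.pi fun _ => a, b.comp (LinearMap.proj 0), by ext x; simp⟩

/-- A map factoring through a finite power of `C` lies in every additive subgroup that contains
all maps factoring through `C`. -/
theorem factorThroughPowers_le {Λ C G Y : Type*} [Ring Λ] [AddCommGroup G] [Module Λ G]
    [AddCommGroup C] [Module Λ C] [AddCommGroup Y] [Module Λ Y]
    {S : AddSubgroup (G →ₗ[Λ] Y)}
    (hS : ∀ (b : C →ₗ[Λ] Y) (a : G →ₗ[Λ] C), b.comp a ∈ S) :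
    factorThroughPowers Λ C G Y ≤ S := by
  rintro _ ⟨n, h, g, rfl⟩
  have key : g.comp h = ∑ i : Fin n,
      (g.comp (LinearMap.single Λ (fun _ => C) i)).comp ((LinearMap.proj i).comp h) := by
    ext x
    simp only [LinearMap.sum_apply, LinearMap.comp_apply, LinearMap.proj_apply,
      LinearMap.single_apply]
    rw [← map_sum, Finset.univ_sum_single]
  rw [key]
  exact sum_mem fun i _ => hS _ _

/-- The subgroup generated by the maps `f ∘ e ∘ r` is the preimage, under restriction to `G`, of
the subgroup of maps factoring through finite powers of `C`. -/
theorem closure_comp_snd_eq_comap (Λ G C Y : Type*) [Ring Λ] [AddCommGroup G] [Module Λ G]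
    [AddCommGroup C] [Module Λ C] [AddCommGroup Y] [Module Λ Y] :
    AddSubgroup.closure {x : (G × C) →ₗ[Λ] Y |
        ∃ (f : (G × C) →ₗ[Λ] Y) (r : Module.End Λ (G × C)),
          x = f.comp (((LinearMap.inr Λ G C).comp (LinearMap.snd Λ G C)).comp r)} =
      (factorThroughPowers Λ C G Y).comap ((LinearMap.inl Λ G C).precompAddHom Y) := by
  apply le_antisymm
  · rw [AddSubgroup.closure_le]
    rintro _ ⟨f, r, rfl⟩
    exact comp_mem_factorThroughPowers (f.comp (LinearMap.inr Λ G C))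
      ((LinearMap.snd Λ G C).comp (r.comp (LinearMap.inl Λ G C)))
  · intro f hf
    have hle := factorThroughPowers_le (Λ := Λ) (C := C) (G := G) (Y := Y)
      (S := (AddSubgroup.closure {x : (G × C) →ₗ[Λ] Y |
        ∃ (f : (G × C) →ₗ[Λ] Y) (r : Module.End Λ (G × C)),
          x = f.comp (((LinearMap.inr Λ G C).comp (LinearMap.snd Λ G C)).comp r)}).comap
        ((LinearMap.fst Λ G C).precompAddHom Y))
      fun b a => AddSubgroup.subset_closure ⟨b.comp (LinearMap.snd Λ G C),
        (LinearMap.inr Λ G C).comp (a.comp (LinearMap.fst Λ G C)), rfl⟩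
    have hsplit : f = (f.comp (LinearMap.inl Λ G C)).comp (LinearMap.fst Λ G C) +
        f.comp (((LinearMap.inr Λ G C).comp (LinearMap.snd Λ G C)).comp LinearMap.id) := by
      ext x <;> simp [← Prod.zero_eq_mk]
    rw [hsplit]
    exact add_mem (hle hf) (AddSubgroup.subset_closure ⟨f, LinearMap.id, rfl⟩)

/-- Proposition 1, identification `N/ReN ≅ F Hom(Γ, M)`: for `D = G × C`, `e ∈ E = End_Λ(D)`
the projection onto `C`, and `K` the subgroup of `Hom_Λ(D,Y)` generated by `{f ∘ e ∘ r}`,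
the map `g ↦ g ∘ ι_G` induces an isomorphism of additive groups
`Hom_Λ(D, Y)/K ≅ Hom_Λ(G, Y)/I_Y`. -/
theorem stmt_12 (k : Type*) [Field k] (Λ : Type*) [Ring Λ] [Algebra k Λ]
    (G : Type*) [AddCommGroup G] [Module Λ G]
    (C : Type*) [AddCommGroup C] [Module Λ C]
    (Y : Type*) [AddCommGroup Y] [Module Λ Y] :
    let E := Module.End Λ (G × C)
    let e : E := (LinearMap.inr Λ G C).comp (LinearMap.snd Λ G C)
    let ιG : G →ₗ[Λ] G × C := LinearMap.inl Λ G C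
    let K : AddSubgroup ((G × C) →ₗ[Λ] Y) :=
      AddSubgroup.closure {x | ∃ (f : (G × C) →ₗ[Λ] Y) (r : E), x = f.comp (e.comp r)}
    ∃ φ : (((G × C) →ₗ[Λ] Y) ⧸ K) ≃+ ((G →ₗ[Λ] Y) ⧸ factorThroughPowers Λ C G Y),
      ∀ g : (G × C) →ₗ[Λ] Y,
        φ (QuotientAddGroup.mk g) = QuotientAddGroup.mk (g.comp ιG) := by
  intro E e ιG K
  let ρ := (QuotientAddGroup.mk' (factorThroughPowers Λ C G Y)).comp (ιG.precompAddHom Y)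
  have hρ : Function.Surjective ρ := by
    refine (QuotientAddGroup.mk'_surjective _).comp fun f => ⟨f.comp (LinearMap.fst Λ G C), ?_⟩
    exact LinearMap.ext fun x => rfl
  have hK : K = ρ.ker := by
    rw [← AddMonoidHom.comap_ker, QuotientAddGroup.ker_mk']
    exact closure_comp_snd_eq_comap Λ G C Y
  exact ⟨(QuotientAddGroup.quotientAddEquivOfEq hK).trans
    (QuotientAddGroup.quotientKerEquivOfSurjective ρ hρ), fun g => rfl⟩
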